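/- arXiv:2305.12645 — 2 statements merged into one kernel-verified Lean document; each statement's English description precedes it below -/
import Mathlib

section
/- Suppose b in GF(q⁴) satisfies Tr_{GF(q⁴)/GF(q)}(b) = 1. Then the equation X^{q²+q+1} + (X+1)^{q²+q+1} = b has exactly 2 solutions in GF(q⁴) if and only if Tr_{GF(q²)/GF(2)}(b^{q²+1}) = 1. -/
open Finset

lemma sum_sq_pow_two_pow {R : Type*} [CommRing R] (n : ℕ) (m : R) (hm : m ^ 2 ^ n = m) :
    ∑ i ∈ range n, (m ^ 2) ^ 2 ^ i = ∑ i ∈ range n, m ^ 2 ^ i := by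
  have h₁ := sum_range_succ (fun i => m ^ 2 ^ i) n
  have h₂ := sum_range_succ' (fun i => m ^ 2 ^ i) n
  simp only [← pow_mul, ← pow_succ']
  simp only [hm, pow_zero, pow_one] at h₁ h₂
  exact add_right_cancel (h₂.symm.trans h₁)

section CharTwo

variable {R : Type*} [CommRing R] [CharP R 2]

lemma add_pow_two_pow_of_charTwo (k : ℕ) (x y : R) :
    (x + y) ^ 2 ^ k = x ^ 2 ^ k + y ^ 2 ^ k :=
  add_pow_char_pow x y 2 k

lemma sum_sq_add_self_pow_two_pow (n : ℕ) (t : R) :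
    ∑ i ∈ range n, (t ^ 2 + t) ^ 2 ^ i = t ^ 2 ^ n + t := by
  induction n with
  | zero => simp [CharTwo.add_self_eq_zero]
  | succ n ih =>
    rw [sum_range_succ, ih, add_pow_two_pow_of_charTwo, ← pow_mul, ← pow_succ']
    linear_combination CharTwo.add_self_eq_zero (t ^ 2 ^ n)

lemma sum_add_pow_two_pow (n : ℕ) (x y : R) :
    ∑ i ∈ range n, (x + y) ^ 2 ^ i
      = ∑ i ∈ range n, x ^ 2 ^ i + ∑ i ∈ range n, y ^ 2 ^ i := by
  simp only [add_pow_two_pow_of_charTwo, sum_add_distrib]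

lemma eq_of_sq_eq_sq_of_charTwo [IsReduced R] {x y : R} (h : x ^ 2 = y ^ 2) : x = y :=
  frobenius_inj R 2 (by simpa [frobenius_def] using h)

end CharTwo

/-- Additive Hilbert 90 for the subfield of `F` fixed by the `2 ^ k`-power map, where
`2 ^ k` has a power equal to the cardinality of `F`. -/
lemma exists_sq_add_self_eq {F : Type*} [Field F] [Fintype F] [CharP F 2] {k n : ℕ}
    (hF : Fintype.card F = (2 ^ k) ^ n) {d : F} (hd : ∑ i ∈ range k, d ^ 2 ^ i = 0) :
    ∃ t : F, t ^ 2 + t = d := by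
  let K := AlgebraicClosure F
  have : CharP K 2 := charP_of_injective_algebraMap (algebraMap F K).injective 2
  obtain ⟨t, ht⟩ : ∃ t : K, t ^ 2 + t = algebraMap F K d := by
    have hdeg : (Polynomial.X ^ 2 + Polynomial.X + Polynomial.C (algebraMap F K d)).degree
        = 2 := by compute_degree!
    obtain ⟨t, ht⟩ := IsAlgClosed.exists_root _ (by rw [hdeg]; decide)
    refine ⟨t, ?_⟩
    simpa [Polynomial.IsRoot, CharTwo.add_eq_zero] using ht
  have hfix : t ^ 2 ^ k = t := by
    rw [← CharTwo.add_eq_zero, ← sum_sq_add_self_pow_two_pow, ht]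
    simpa using congrArg (algebraMap F K) hd
  have hcard : t ^ Fintype.card F = t := by
    rw [hF]
    clear hF
    induction n with
    | zero => simp
    | succ n ih => rw [pow_succ, pow_mul, ih, hfix]
  have hsplits : (Polynomial.X ^ Fintype.card F - Polynomial.X : Polynomial F).Splits := by
    rw [Polynomial.splits_iff_card_roots, FiniteField.roots_X_pow_card_sub_X,
      FiniteField.X_pow_card_sub_X_natDegree_eq F Fintype.one_lt_card, ← card_def, card_univ]
  have hroots := hsplits.roots_map (algebraMap F K)
  have hmem : t ∈ ((Polynomial.X ^ Fintype.card F - Polynomial.X : Polynomial F).map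
      (algebraMap F K)).roots := by
    simpa [hcard] using FiniteField.X_pow_card_sub_X_ne_zero K (Fintype.one_lt_card (α := F))
  rw [hroots, FiniteField.roots_X_pow_card_sub_X, Multiset.mem_map] at hmem
  obtain ⟨u, -, rfl⟩ := hmem
  exact ⟨u, (algebraMap F K).injective (by simpa using ht)⟩

/-- With `a` the square root of `b ^ q`, the solutions of the equation are the `a + t`
with `t` fixed by the `q`-power map and a root of an Artin–Schreier polynomial. -/
lemma solution_iff {F : Type*} [Field F] [CharP F 2] (k : ℕ) {q : ℕ} (hq : q = 2 ^ k)
    (hfix : ∀ u : F, (((u ^ q) ^ q) ^ q) ^ q = u) {a₀ a₁ a₂ a₃ : F}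
    (h₁ : a₀ ^ q = a₁) (h₂ : a₁ ^ q = a₂) (h₃ : a₂ ^ q = a₃)
    (htr : a₀ + a₁ + a₂ + a₃ = 1) (x : F) :
    x ^ (q ^ 2 + q + 1) + (x + 1) ^ (q ^ 2 + q + 1) = a₃ ^ 2 ↔
      (x + a₀) ^ q = x + a₀ ∧
        (x + a₀) ^ 2 + (x + a₀)
          = (a₀ + a₂) ^ 2 + (a₀ + a₂) + (a₁ * a₃ + a₀ * a₂) := by
  have hadd (u v : F) : (u + v) ^ q = u ^ q + v ^ q := by
    rw [hq, add_pow_two_pow_of_charTwo]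
  have hexp (u : F) : u ^ (q ^ 2 + q + 1) = (u ^ q) ^ q * u ^ q * u := by ring
  have h₀ : a₃ ^ q = a₀ := by rw [← h₃, ← h₂, ← h₁, hfix]
  obtain ⟨y, hy⟩ : ∃ y, x ^ q = y := ⟨_, rfl⟩
  obtain ⟨z, hz⟩ : ∃ z, y ^ q = z := ⟨_, rfl⟩
  obtain ⟨w, hw⟩ : ∃ w, z ^ q = w := ⟨_, rfl⟩
  have hx : w ^ q = x := by rw [← hw, ← hz, ← hy, hfix]
  simp only [hexp, hadd, one_pow, hy, hz, h₁]
  constructor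
  · intro e₀
    have conj {u v : F} (h : u = v) : u ^ q = v ^ q := by rw [h]
    have e₁ := conj e₀
    simp only [hadd, mul_pow, one_pow, pow_right_comm _ 2 q, hy, hz, hw, h₀] at e₁
    have e₂ := conj e₁
    simp only [hadd, mul_pow, one_pow, pow_right_comm _ 2 q, hx, hz, hw, h₁] at e₂
    have e₃ := conj e₂
    simp only [hadd, mul_pow, one_pow, pow_right_comm _ 2 q, hx, hy, hw, h₂] at e₃
    have hT : x + y + z + w = 1 := by grind
    have s₁ : y + w = a₁ + a₃ := eq_of_sq_eq_sq_of_charTwo (by grind)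
    have s₀ : x + z = a₀ + a₂ := by grind
    have ht : x + a₀ = y + a₁ := eq_of_sq_eq_sq_of_charTwo (by grind)
    exact ⟨ht.symm, by grind⟩
  · rintro ⟨ht, e⟩
    have ht' := congrArg (· ^ q) ht
    simp only [hadd, hy, hz, h₁, h₂] at ht'
    grind

theorem stmt7 (k : ℕ) (hk : 0 < k) (q : ℕ) (hq : q = 2^k) {F : Type*} [Field F] [Fintype F] [DecidableEq F] (hF : Fintype.card F = q^4) (b : F) (hb : (b + b^q + b^(q^2) + b^(q^3)) = 1) :
    (Finset.univ.filter (fun x : F => (x^(q^2+q+1) + (x+1)^(q^2+q+1)) = b)).card = 2 ↔ (∑ i ∈ Finset.range (2*k), (b^(q^2+1))^(2^i)) = 1 := by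
  have : Fact (Nat.Prime 2) := ⟨Nat.prime_two⟩
  have : CharP F 2 := charP_of_card_eq_prime_pow (f := k * 4) (by rw [hF, hq, pow_mul])
  have hadd (u v : F) : (u + v) ^ q = u ^ q + v ^ q := by
    rw [hq, add_pow_two_pow_of_charTwo]
  have hfix (u : F) : (((u ^ q) ^ q) ^ q) ^ q = u := by
    conv_rhs => rw [← FiniteField.pow_card u, hF]
    ring
  obtain ⟨c, rfl⟩ : ∃ c : F, c ^ 2 = b :=
    (FiniteField.isSquare_of_char_two (CharP.eq F (ringChar.charP F) ‹_›) b).imp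
      fun c hc => by rw [hc, sq]
  obtain ⟨a₀, h₀⟩ : ∃ y, c ^ q = y := ⟨_, rfl⟩
  obtain ⟨a₁, h₁⟩ : ∃ y, a₀ ^ q = y := ⟨_, rfl⟩
  obtain ⟨a₂, h₂⟩ : ∃ y, a₁ ^ q = y := ⟨_, rfl⟩
  have h₃ : a₂ ^ q = c := by rw [← h₂, ← h₁, ← h₀, hfix]
  have hc₁ : c ^ q ^ 2 = a₁ := by rw [← h₁, ← h₀]; ring
  have hc₂ : c ^ q ^ 3 = a₂ := by rw [← h₂, ← h₁, ← h₀]; ring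
  have htr : a₀ + a₁ + a₂ + c = 1 := by
    apply eq_of_sq_eq_sq_of_charTwo
    simp only [pow_right_comm c 2, h₀, hc₁, hc₂] at hb
    grind
  have hsol := solution_iff k hq hfix h₁ h₂ h₃ htr
  obtain ⟨d, hd⟩ : ∃ d, (a₀ + a₂) ^ 2 + (a₀ + a₂) + (a₁ * c + a₀ * a₂) = d := ⟨_, rfl⟩
  simp only [hd] at hsol
  have hm : (a₁ * c) ^ q = a₀ * a₂ := by rw [mul_pow, h₂, h₀, mul_comm]
  have hm' : (a₀ * a₂) ^ q = a₁ * c := by rw [mul_pow, h₁, h₃]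
  have hsum : ∑ i ∈ range (2 * k), ((c ^ 2) ^ (q ^ 2 + 1)) ^ 2 ^ i
      = ∑ i ∈ range k, d ^ 2 ^ i + 1 := by
    have hb' : (c ^ 2) ^ (q ^ 2 + 1) = (a₁ * c) ^ 2 := by rw [← hc₁]; ring
    rw [hb', sum_sq_pow_two_pow, two_mul, sum_range_add, ← hd, sum_add_pow_two_pow k (_ + _) (_ + _),
      sum_add_pow_two_pow k (a₁ * c), sum_sq_add_self_pow_two_pow, ← hq, hadd, h₁, h₃]
    · simp only [pow_add, pow_mul, ← hq, hm]
      grind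
    · rw [two_mul, pow_add, pow_mul, ← hq, hm, hm']
  rw [hsum, add_eq_right]
  constructor
  · intro h
    obtain ⟨x, hx⟩ := card_pos.mp (h ▸ Nat.two_pos)
    obtain ⟨ht, ht'⟩ := (hsol x).mp (mem_filter.mp hx).2
    rw [← ht', sum_sq_add_self_pow_two_pow, ← hq, ht, CharTwo.add_self_eq_zero]
  · intro h
    obtain ⟨t, ht⟩ := exists_sq_add_self_eq (hq ▸ hF) h
    have htq : t ^ q = t := by
      rw [← CharTwo.add_eq_zero, hq, ← sum_sq_add_self_pow_two_pow, ht, h]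
    rw [card_eq_two]
    refine ⟨a₀ + t, a₀ + t + 1, by simp, ?_⟩
    ext x
    simp only [mem_filter, mem_univ, true_and, hsol, mem_insert, mem_singleton]
    constructor
    · rintro ⟨-, hx⟩
      have : (x - (a₀ + t)) * (x - (a₀ + t + 1)) = 0 := by grind
      simpa [sub_eq_zero] using this
    · rintro (rfl | rfl)
      · have : a₀ + t + a₀ = t := by grind
        rw [this]
        exact ⟨htq, ht⟩
      · have : a₀ + t + 1 + a₀ = t + 1 := by grind
        rw [this, hadd, htq, one_pow]
        exact ⟨rfl, by grind⟩
end

section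
/- Let N_i be the number of b in GF(q⁴) such that X^{q²+q+1} + (X+1)^{q²+q+1} = b has exactly i solutions in GF(q⁴). Then N_0 = (5q⁴ - q³)/8, N_2 = (q⁴ + q³)/4, and N_4 = (q⁴ - q³)/8. -/
open Finset

/-- The derivative of `x ↦ x ^ (q ^ 2 + q + 1)` in direction `1`, where `φ` is `x ↦ x ^ q`. -/
def blDeriv {F : Type*} [Field F] (φ : F →+* F) (x : F) : F :=
  φ (φ x) * φ x * x + φ (φ (x + 1)) * φ (x + 1) * (x + 1)

/-- The trace attached to an automorphism of order dividing four. -/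
def traceFour {F : Type*} [Field F] (φ : F →+* F) (x : F) : F :=
  x + φ x + φ (φ x) + φ (φ (φ x))

/-- The condition on `x` for its fibre under `blDeriv φ` to have four elements. -/
def HasPartner {F : Type*} [Field F] (φ : F →+* F) (x : F) : Prop :=
  traceFour φ x ≠ 1 ∧ ∃ a, φ a + a = traceFour φ x + 1 ∧
    a ^ 2 + a = (traceFour φ x + 1) * (x + φ (φ x) + 1)

theorem traceFour_fixed {F : Type*} [Field F] {φ : F →+* F}
    (hφ : ∀ x, φ (φ (φ (φ x))) = x) (x : F) :
    φ (traceFour φ x) = traceFour φ x := by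
  simp only [traceFour, map_add, hφ]
  ring

section Algebra

variable {F : Type*} [Field F] [CharP F 2] {φ : F →+* F}

theorem blDeriv_eq (x : F) :
    blDeriv φ x = x * φ x + φ x * φ (φ x) + x * φ (φ x) + x + φ x + φ (φ x) + 1 := by
  have h2 : (2 : F) = 0 := CharTwo.two_eq_zero
  simp only [blDeriv, map_add, map_one]
  linear_combination (φ (φ x) * φ x * x) * h2

theorem traceFour_eq_of_blDeriv_eq (hφ : ∀ x, φ (φ (φ (φ x))) = x) {x y : F}
    (h : blDeriv φ x = blDeriv φ y) : traceFour φ x = traceFour φ y := by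
  have h2 : (2 : F) = 0 := CharTwo.two_eq_zero
  have key : ∀ z : F, blDeriv φ z + φ (blDeriv φ z) +
      φ (φ (blDeriv φ z + φ (blDeriv φ z))) = traceFour φ z := by
    intro z
    simp only [blDeriv_eq, traceFour, map_add, map_mul, map_one, hφ]
    grind
  rw [← key x, ← key y, h]

theorem map_add_self_of_blDeriv_eq (hφ : ∀ x, φ (φ (φ (φ x))) = x) {x a : F}
    (h : blDeriv φ (x + a) = blDeriv φ x) :
    φ a + a = 0 ∨ φ a + a = traceFour φ x + 1 := by
  have h2 : (2 : F) = 0 := CharTwo.two_eq_zero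
  have hT := traceFour_eq_of_blDeriv_eq hφ h
  have key : ∀ z : F, blDeriv φ z + φ (blDeriv φ z) =
      (φ (φ z + z) + 1) * (φ (φ z + z) + traceFour φ z) := by
    intro z
    simp only [blDeriv_eq, traceFour, map_add, map_mul, map_one]
    grind
  have h1 := key (x + a)
  rw [h, key x, hT, map_add φ x a] at h1
  have h3 : φ (φ a + a) * (φ (φ a + a) + φ (traceFour φ x + 1)) = 0 := by
    rw [map_add φ _ (1 : F), traceFour_fixed hφ, map_one]
    generalize traceFour φ x = s at *
    simp only [map_add] at *
    grind
  rcases mul_eq_zero.1 h3 with h4 | h4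
  · left
    exact (map_eq_zero φ).1 h4
  · right
    exact φ.injective (CharTwo.add_eq_zero.1 h4)

theorem blDeriv_add_fixed_iff {x a : F} (ha : φ a = a) :
    blDeriv φ (x + a) = blDeriv φ x ↔ a = 0 ∨ a = 1 := by
  have h2 : (2 : F) = 0 := CharTwo.two_eq_zero
  have key : blDeriv φ (x + a) = blDeriv φ x + a * (a + 1) := by
    simp only [blDeriv_eq, map_add, ha]
    grind
  rw [key, add_eq_left, mul_eq_zero, CharTwo.add_eq_zero]

theorem blDeriv_add_iff (hφ : ∀ x, φ (φ (φ (φ x))) = x) {x a : F}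
    (ha : φ a + a = traceFour φ x + 1) :
    blDeriv φ (x + a) = blDeriv φ x ↔
      a ^ 2 + a = (traceFour φ x + 1) * (x + φ (φ x) + 1) := by
  have h2 : (2 : F) = 0 := CharTwo.two_eq_zero
  have hs := traceFour_fixed hφ x
  generalize traceFour φ x = s at *
  have h1 : φ a = s + 1 + a := by grind
  have key : blDeriv φ (x + a) = blDeriv φ x + (a ^ 2 + a + (s + 1) * (x + φ (φ x) + 1)) := by
    simp only [blDeriv_eq, map_add, h1, hs, map_one]
    grind
  rw [key, add_eq_left, CharTwo.add_eq_zero]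

theorem card_fibre_of_hasPartner [Fintype F] [DecidableEq F] (hφ : ∀ x, φ (φ (φ (φ x))) = x)
    {x : F} (hx : HasPartner φ x) :
    (univ.filter fun y => blDeriv φ y = blDeriv φ x).card = 4 := by
  have h2 : (2 : F) = 0 := CharTwo.two_eq_zero
  obtain ⟨hT, a, ha, ha'⟩ := hx
  have hT' : traceFour φ x + 1 ≠ 0 := fun h => hT (CharTwo.add_eq_zero.1 h)
  have ha0 : a ≠ 0 := by
    rintro rfl
    exact hT' (by rw [← ha]; simp)
  have ha1 : a ≠ 1 := by
    rintro rfl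
    exact hT' (by rw [← ha, map_one]; exact CharTwo.add_self_eq_zero 1)
  have hset : (univ.filter fun y => blDeriv φ y = blDeriv φ x) =
      {x, x + 1, x + a, x + a + 1} := by
    ext y
    simp only [mem_filter, mem_univ, true_and, mem_insert, mem_singleton]
    have hxa := (blDeriv_add_iff hφ ha).2 ha'
    constructor
    · intro h
      obtain ⟨c, rfl⟩ : ∃ c, y = x + c := ⟨y - x, by ring⟩
      rcases map_add_self_of_blDeriv_eq hφ h with hc | hc
      · rcases (blDeriv_add_fixed_iff (CharTwo.add_eq_zero.1 hc)).1 h with rfl | rfl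
        · left; ring
        · right; left; rfl
      · have hca : φ (c + a) = c + a := by
          rw [map_add]
          grind
        have h3 : blDeriv φ ((x + a) + (c + a)) = blDeriv φ (x + a) := by
          rw [hxa, ← h]
          congr 1
          grind
        rcases (blDeriv_add_fixed_iff hca).1 h3 with h4 | h4
        · right; right; left; grind
        · right; right; right; grind
    · rintro (rfl | rfl | rfl | rfl)
      · rfl
      · exact (blDeriv_add_fixed_iff (map_one φ)).2 (Or.inr rfl)
      · exact hxa
      · rw [(blDeriv_add_fixed_iff (map_one φ)).2 (Or.inr rfl), hxa]
  rw [hset]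
  have h1 : (1 : F) ≠ 0 := one_ne_zero
  rw [card_insert_of_notMem, card_insert_of_notMem, card_insert_of_notMem, card_singleton]
  all_goals
    simp only [mem_insert, mem_singleton]
    grind

theorem card_fibre_of_not_hasPartner [Fintype F] [DecidableEq F]
    (hφ : ∀ x, φ (φ (φ (φ x))) = x) {x : F} (hx : ¬ HasPartner φ x) :
    (univ.filter fun y => blDeriv φ y = blDeriv φ x).card = 2 := by
  have hset : (univ.filter fun y => blDeriv φ y = blDeriv φ x) = {x, x + 1} := by
    ext y
    simp only [mem_filter, mem_univ, true_and, mem_insert, mem_singleton]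
    constructor
    · intro h
      obtain ⟨c, rfl⟩ : ∃ c, y = x + c := ⟨y - x, by ring⟩
      have hc : φ c + c = 0 := by
        rcases map_add_self_of_blDeriv_eq hφ h with hc | hc
        · exact hc
        · by_cases hT : traceFour φ x = 1
          · rw [hc, hT]
            exact CharTwo.add_self_eq_zero 1
          · exact absurd ⟨hT, c, hc, (blDeriv_add_iff hφ hc).1 h⟩ hx
      rcases (blDeriv_add_fixed_iff (CharTwo.add_eq_zero.1 hc)).1 h with rfl | rfl
      · left; ring
      · right; rfl
    · rintro (rfl | rfl)
      · rfl
      · exact (blDeriv_add_fixed_iff (map_one φ)).2 (Or.inr rfl)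
  rw [hset, card_pair]
  simp

theorem traceFour_add_div (hφ : ∀ x, φ (φ (φ (φ x))) = x) {d w : F} (hd : φ d + d = 1)
    (hw : φ (φ w) + w = d ^ 2 + d) (x : F) :
    traceFour φ (x + w / (traceFour φ x + 1)) = traceFour φ x := by
  have h2 : (2 : F) = 0 := CharTwo.two_eq_zero
  have hs := traceFour_fixed hφ x
  have hd' : φ d = 1 + d := by grind
  have hw' : φ (φ w) = w + (d ^ 2 + d) := by grind
  generalize hsx : traceFour φ x = s at *
  have hw0 : traceFour φ (w / (s + 1)) = 0 := by
    simp only [traceFour, map_div₀, map_add, hs, map_one, hw', ← add_div]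
    rw [div_eq_zero_iff]
    left
    grind
  have hadd : traceFour φ (x + w / (s + 1)) = traceFour φ x + traceFour φ (w / (s + 1)) := by
    simp only [traceFour, map_add]
    ring
  rw [hadd, hw0, add_zero, hsx]

theorem hasPartner_add_div_iff (hφ : ∀ x, φ (φ (φ (φ x))) = x)
    (hAS : ∀ e, φ (φ e) = e → ∃ a : F, a ^ 2 + a = e)
    {d w : F} (hd : φ d + d = 1) (hw : φ (φ w) + w = d ^ 2 + d)
    {x : F} (hx : traceFour φ x ≠ 1) :
    HasPartner φ (x + w / (traceFour φ x + 1)) ↔ ¬ HasPartner φ x := by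
  have h2 : (2 : F) = 0 := CharTwo.two_eq_zero
  have hT := traceFour_add_div hφ hd hw x
  have hs := traceFour_fixed hφ x
  have hsd : traceFour φ x = x + φ x + φ (φ x) + φ (φ (φ x)) := rfl
  have hs1 : traceFour φ x + 1 ≠ 0 := fun h => hx (CharTwo.add_eq_zero.1 h)
  simp only [HasPartner, hT]
  generalize traceFour φ x = s at *
  obtain ⟨a, ha⟩ := hAS ((s + 1) * (x + φ (φ x) + 1)) (by
    simp only [map_mul, map_add, hs, map_one, hφ]
    ring)
  have hfix : (φ a + a + (s + 1)) * (φ a + a + (s + 1) + 1) = 0 := by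
    have h := congrArg φ ha
    simp only [map_mul, map_add, map_pow, hs, map_one] at h
    grind
  have hshift : (s + 1) * (x + w / (s + 1) + φ (φ (x + w / (s + 1))) + 1) =
      a ^ 2 + a + (d ^ 2 + d) := by
    have h : (s + 1) * (x + w / (s + 1) + φ (φ (x + w / (s + 1))) + 1) =
        (s + 1) * (x + φ (φ x) + 1) + (φ (φ w) + w) := by
      simp only [map_add, map_div₀, hs, map_one]
      field_simp
      ring
    rw [h, ha, hw]
  have hroot : ∀ {a b : F}, b ^ 2 + b = a ^ 2 + a → φ b + b = φ a + a := by
    intro a b h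
    have h1 : (b + a) * (b + a + 1) = 0 := by grind
    rcases mul_eq_zero.1 h1 with h3 | h3
    · rw [CharTwo.add_eq_zero.1 h3]
    · have : b = a + 1 := by grind
      rw [this, map_add, map_one]
      grind
  rw [hshift, ← ha]
  have e1 : (∃ b, φ b + b = s + 1 ∧ b ^ 2 + b = a ^ 2 + a) ↔ φ a + a = s + 1 :=
    ⟨fun ⟨b, hb, hb'⟩ => (hroot hb').symm.trans hb, fun h => ⟨a, h, rfl⟩⟩
  have e2 : (∃ b, φ b + b = s + 1 ∧ b ^ 2 + b = a ^ 2 + a + (d ^ 2 + d)) ↔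
      φ a + a = s := by
    have hsum : φ (a + d) + (a + d) = φ a + a + 1 := by
      rw [map_add]
      linear_combination hd
    have hsq : (a + d) ^ 2 + (a + d) = a ^ 2 + a + (d ^ 2 + d) := by
      linear_combination (a * d) * h2
    rw [← hsq]
    constructor
    · rintro ⟨b, hb, hb'⟩
      have := (hroot hb').symm.trans hb
      rw [hsum] at this
      exact add_right_cancel this
    · intro h
      exact ⟨a + d, by rw [hsum, h], rfl⟩
  rw [e1, e2]
  have h1 : (1 : F) ≠ 0 := one_ne_zero
  rcases mul_eq_zero.1 hfix with h | h <;> grind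

theorem two_mul_card_hasPartner [Fintype F] [DecidableEq F] [DecidablePred (HasPartner φ)]
    (hφ : ∀ x, φ (φ (φ (φ x))) = x)
    (hAS : ∀ e, φ (φ e) = e → ∃ a : F, a ^ 2 + a = e)
    {d w : F} (hd : φ d + d = 1) (hw : φ (φ w) + w = d ^ 2 + d) :
    2 * (univ.filter (HasPartner φ)).card = (univ.filter fun x => traceFour φ x ≠ 1).card := by
  have hinv : ∀ x, x + w / (traceFour φ x + 1) + w / (traceFour φ x + 1) = x := by
    intro x
    rw [add_assoc, CharTwo.add_self_eq_zero, add_zero]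
  have hcard : (univ.filter (HasPartner φ)).card =
      ((univ.filter fun x => traceFour φ x ≠ 1).filter fun x => ¬ HasPartner φ x).card := by
    refine card_bij' (fun x _ => x + w / (traceFour φ x + 1))
      (fun x _ => x + w / (traceFour φ x + 1)) ?_ ?_ ?_ ?_
    · intro x hx
      have hx' := (mem_filter.1 hx).2
      simp only [mem_filter, mem_univ, true_and, traceFour_add_div hφ hd hw]
      exact ⟨hx'.1, fun h => (hasPartner_add_div_iff hφ hAS hd hw hx'.1).1 h hx'⟩
    · intro x hx
      simp only [mem_filter, mem_univ, true_and] at hx ⊢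
      exact (hasPartner_add_div_iff hφ hAS hd hw hx.1).2 hx.2
    · intro x _
      simp only [traceFour_add_div hφ hd hw, hinv]
    · intro x _
      simp only [traceFour_add_div hφ hd hw, hinv]
  have hsplit := card_filter_add_card_filter_not
    (s := univ.filter fun x => traceFour φ x ≠ 1) (HasPartner φ)
  rw [← hcard, filter_filter] at hsplit
  have hP : (univ.filter fun x => traceFour φ x ≠ 1 ∧ HasPartner φ x) =
      univ.filter (HasPartner φ) :=
    filter_congr fun x _ => ⟨fun h => h.2, fun h => ⟨h.1, h⟩⟩
  rw [hP] at hsplit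
  omega

end Algebra

section FiniteField

variable {F : Type*} [Field F] [Fintype F] [DecidableEq F]

open Polynomial in
theorem card_trace_fibre_le {Q m : ℕ} (hQ : 1 < Q) (c : F) :
    (univ.filter fun x : F => ∑ i ∈ range (m + 1), x ^ Q ^ i = c).card ≤ Q ^ m := by
  set p : F[X] := ∑ i ∈ range (m + 1), X ^ Q ^ i - C c with hp
  have hlow : (∑ i ∈ range m, (X : F[X]) ^ Q ^ i - C c).degree < ((Q ^ m : ℕ) : WithBot ℕ) := by
    refine (degree_sub_le _ _).trans_lt (max_lt ?_ ?_)
    · refine (degree_sum_le _ _).trans_lt ?_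
      rw [Finset.sup_lt_iff (WithBot.bot_lt_coe _)]
      intro i hi
      rw [degree_X_pow]
      exact_mod_cast Nat.pow_lt_pow_right hQ (mem_range.1 hi)
    · refine degree_C_le.trans_lt ?_
      exact_mod_cast pow_pos (by omega : 0 < Q) m
  have hdeg : p.degree = ((Q ^ m : ℕ) : WithBot ℕ) := by
    have : p = X ^ Q ^ m + (∑ i ∈ range m, X ^ Q ^ i - C c) := by
      rw [hp, sum_range_succ]
      ring
    rw [this, degree_add_eq_left_of_degree_lt (by rwa [degree_X_pow]), degree_X_pow]
  have hp0 : p ≠ 0 := by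
    rintro h
    rw [h, degree_zero] at hdeg
    exact WithBot.bot_ne_coe hdeg
  have hsub : (univ.filter fun x : F => ∑ i ∈ range (m + 1), x ^ Q ^ i = c) ⊆ p.roots.toFinset := by
    intro x hx
    rw [Multiset.mem_toFinset, mem_roots hp0, IsRoot.def, hp]
    simpa [eval_finsetSum, sub_eq_zero] using hx
  calc _ ≤ p.roots.toFinset.card := card_le_card hsub
    _ ≤ p.roots.card := Multiset.toFinset_card_le _
    _ ≤ p.natDegree := p.card_roots'
    _ = Q ^ m := natDegree_eq_of_degree_eq_some hdeg

theorem card_add_pow_fibre_le {Q : ℕ} (hQ : 1 < Q) (c : F) :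
    (univ.filter fun x : F => x ^ Q + x = c).card ≤ Q := by
  have := card_trace_fibre_le (m := 1) hQ c
  simpa [sum_range_succ, add_comm] using this

variable [CharP F 2]

/-- Additive Hilbert 90 for finite fields of characteristic two. -/
theorem exists_pow_add_self_eq {j m : ℕ} (hj : 0 < j)
    (hF : Fintype.card F = (2 ^ j) ^ (m + 1)) {e : F}
    (he : ∑ i ∈ range (m + 1), e ^ (2 ^ j) ^ i = 0) : ∃ a : F, a ^ 2 ^ j + a = e := by
  set Q := 2 ^ j with hQ
  have hQ1 : 1 < Q := Nat.one_lt_two_pow hj.ne'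
  have hadd : ∀ (i : ℕ) (x y : F), (x + y) ^ Q ^ i = x ^ Q ^ i + y ^ Q ^ i := by
    intro i x y
    rw [hQ, ← pow_mul]
    exact add_pow_char_pow x y 2 _
  set K := univ.filter fun x : F => ∑ i ∈ range (m + 1), x ^ Q ^ i = 0
  set I := univ.image fun x : F => x ^ Q + x
  have hIK : I ⊆ K := by
    intro y hy
    obtain ⟨x, -, rfl⟩ := mem_image.1 hy
    simp only [K, mem_filter, mem_univ, true_and, hadd, ← pow_mul, ← pow_succ']
    rw [sum_add_distrib, sum_range_succ, sum_range_succ' (fun i => x ^ Q ^ i), ← hF,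
      FiniteField.pow_card, pow_zero, pow_one]
    exact CharTwo.add_self_eq_zero _
  have hcard : Fintype.card F ≤ Q * I.card :=
    card_le_mul_card_image (univ : Finset F) Q fun c _ => card_add_pow_fibre_le hQ1 c
  have hKI : K.card ≤ I.card := by
    refine (card_trace_fibre_le hQ1 0).trans ?_
    rw [hF, pow_succ'] at hcard
    exact Nat.le_of_mul_le_mul_left hcard (by omega)
  have heK : e ∈ I := by
    rw [eq_of_subset_of_card_le hIK hKI]
    simpa [K] using he
  obtain ⟨a, -, ha⟩ := mem_image.1 heK
  exact ⟨a, ha⟩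

end FiniteField

theorem card_traceFour_eq_one {F : Type*} [Field F] [Fintype F] [DecidableEq F] [CharP F 2]
    {φ : F →+* F} (hφ : ∀ x, φ (φ (φ (φ x))) = x) {q : ℕ} (hq : 1 < q)
    (hφq : ∀ x, φ x = x ^ q) (hF : Fintype.card F = q ^ 4) :
    (univ.filter fun x => traceFour φ x = 1).card = q ^ 3 := by
  have hle : ∀ c : F, (univ.filter fun x => traceFour φ x = c).card ≤ q ^ 3 := by
    intro c
    refine le_of_eq_of_le ?_ (card_trace_fibre_le (m := 3) hq c)
    congr 1
    refine filter_congr fun x _ => ?_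
    simp only [traceFour, hφq, sum_range_succ, sum_range_zero, zero_add, ← pow_mul]
    ring_nf
  set B := univ.filter fun c : F => φ c = c with hB
  have hBcard : B.card ≤ q := by
    refine le_of_eq_of_le ?_ (card_add_pow_fibre_le hq (0 : F))
    congr 1
    refine filter_congr fun x _ => ?_
    rw [hφq, CharTwo.add_eq_zero]
  have hsum := card_eq_sum_card_fiberwise (s := (univ : Finset F)) (t := B)
    (f := traceFour φ) fun x _ => by simp [hB, traceFour_fixed hφ]
  have h1 : (1 : F) ∈ B := by simp [hB]
  rw [card_univ, hF, ← add_sum_erase _ _ h1] at hsum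
  have hrest : ∑ c ∈ B.erase 1, (univ.filter fun x => traceFour φ x = c).card ≤
      (q - 1) * q ^ 3 := by
    refine (sum_le_card_nsmul _ _ _ fun c _ => hle c).trans ?_
    rw [smul_eq_mul, card_erase_of_mem h1]
    gcongr
  obtain ⟨r, rfl⟩ : ∃ r, q = r + 1 := ⟨q - 1, by omega⟩
  rw [Nat.add_sub_cancel] at hrest
  have := hle 1
  have : (r + 1) ^ 4 = r * (r + 1) ^ 3 + (r + 1) ^ 3 := by ring
  omega

/-- Counting points and values of a map whose nonempty fibres have two or four elements. -/
theorem card_fibres_two_four {α β : Type*} [Fintype α] [Fintype β] [DecidableEq β] (f : α → β)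
    (P : α → Prop) [DecidablePred P]
    (h4 : ∀ x, P x → (univ.filter fun y => f y = f x).card = 4)
    (h2 : ∀ x, ¬ P x → (univ.filter fun y => f y = f x).card = 2) :
    4 * (univ.filter fun b => (univ.filter fun y => f y = b).card = 4).card =
        (univ.filter P).card ∧
      2 * (univ.filter fun b => (univ.filter fun y => f y = b).card = 2).card =
        (univ.filter fun x => ¬ P x).card ∧
      (univ.filter fun b => (univ.filter fun y => f y = b).card = 0).card +
        (univ.filter fun b => (univ.filter fun y => f y = b).card = 2).card +
        (univ.filter fun b => (univ.filter fun y => f y = b).card = 4).card =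
        Fintype.card β := by
  have hP : ∀ x, P x ↔ (univ.filter fun y => f y = f x).card = 4 := by
    intro x
    refine ⟨h4 x, fun h => ?_⟩
    by_contra hx
    have := h2 x hx
    omega
  have hP' : ∀ x, ¬ P x ↔ (univ.filter fun y => f y = f x).card = 2 := by
    intro x
    refine ⟨h2 x, fun h hx => ?_⟩
    have := h4 x hx
    omega
  have count : ∀ n, (univ.filter fun x => (univ.filter fun y => f y = f x).card = n).card =
      n * (univ.filter fun b => (univ.filter fun y => f y = b).card = n).card := by
    intro n
    rw [card_eq_sum_card_fiberwise (f := f)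
      (t := univ.filter fun b => (univ.filter fun y => f y = b).card = n)
      (fun x hx => by simpa using hx), mul_comm]
    refine sum_const_nat fun b hb => ?_
    rw [mem_filter] at hb
    rw [filter_filter, ← hb.2]
    congr 1
    refine filter_congr fun x _ => ⟨fun h => h.2, fun h => ⟨?_, h⟩⟩
    rw [h]
  refine ⟨?_, ?_, ?_⟩
  · rw [← count, filter_congr fun x _ => hP x]
  · rw [← count, filter_congr fun x _ => hP' x]
  · have hval : ∀ b, (univ.filter fun y => f y = b).card = 0 ∨
        (univ.filter fun y => f y = b).card = 2 ∨ (univ.filter fun y => f y = b).card = 4 := by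
      intro b
      by_cases hb : ∃ x, f x = b
      · obtain ⟨x, rfl⟩ := hb
        by_cases hx : P x
        · exact Or.inr (Or.inr (h4 x hx))
        · exact Or.inr (Or.inl (h2 x hx))
      · left
        rw [card_eq_zero, filter_eq_empty_iff]
        exact fun y _ h => hb ⟨y, h⟩
    rw [← card_univ, card_eq_sum_card_fiberwise (s := (univ : Finset β)) (t := {0, 2, 4})
      (f := fun b => (univ.filter fun y => f y = b).card) (fun b _ => by simpa using hval b)]
    simp [add_assoc]

theorem stmt19 (k : ℕ) (hk : 0 < k) (q : ℕ) (hq : q = 2^k) {F : Type*} [Field F] [Fintype F] [DecidableEq F] (hF : Fintype.card F = q^4) :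
    (Finset.univ.filter (fun b : F => (Finset.univ.filter (fun x : F => (x^(q^2+q+1) + (x+1)^(q^2+q+1)) = b)).card = 0)).card = (5*q^4 - q^3) / 8 ∧ (Finset.univ.filter (fun b : F => (Finset.univ.filter (fun x : F => (x^(q^2+q+1) + (x+1)^(q^2+q+1)) = b)).card = 2)).card = (q^4 + q^3) / 4 ∧ (Finset.univ.filter (fun b : F => (Finset.univ.filter (fun x : F => (x^(q^2+q+1) + (x+1)^(q^2+q+1)) = b)).card = 4)).card = (q^4 - q^3) / 8 := by
  subst hq
  have hq1 : 1 < 2 ^ k := Nat.one_lt_two_pow hk.ne'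
  have : CharP F 2 := by
    have : Fact (Nat.Prime 2) := ⟨Nat.prime_two⟩
    exact charP_of_card_eq_prime_pow (f := k * 4) (by rw [hF, ← pow_mul])
  have htwo : (2 : F) = 0 := CharTwo.two_eq_zero
  set φ : F →+* F := iterateFrobenius F 2 k with hφdef
  have hφq : ∀ x, φ x = x ^ 2 ^ k := fun x => iterateFrobenius_def 2 k x
  have hφφ : ∀ x, φ (φ x) = x ^ (2 ^ k) ^ 2 := fun x => by
    rw [hφq, hφq, ← pow_mul, sq]
  have hφ : ∀ x, φ (φ (φ (φ x))) = x := fun x => by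
    rw [hφφ, hφφ, ← pow_mul, ← pow_add, ← hF, FiniteField.pow_card]
  have hAS : ∀ e, φ (φ e) = e → ∃ a : F, a ^ 2 + a = e := by
    intro e he
    have hm : 4 * k - 1 + 1 = 2 * k + 2 * k := by omega
    have hF' : Fintype.card F = (2 ^ 1) ^ (4 * k - 1 + 1) := by
      rw [hF, hm, ← pow_mul]
      ring
    refine exists_pow_add_self_eq one_pos hF' ?_
    rw [hm, sum_range_add, ← sum_add_distrib]
    refine sum_eq_zero fun i _ => ?_
    rw [hφφ] at he
    have : (2 ^ 1) ^ (2 * k + i) = (2 ^ k) ^ 2 * 2 ^ i := by ring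
    rw [this, pow_mul e, he, pow_one]
    exact CharTwo.add_self_eq_zero _
  obtain ⟨d, hd⟩ : ∃ d, φ d + d = 1 := by
    simp only [hφq]
    refine exists_pow_add_self_eq (m := 3) hk hF ?_
    simp only [one_pow, sum_const, card_range]
    linear_combination 2 * htwo
  obtain ⟨w, hw⟩ : ∃ w, φ (φ w) + w = d ^ 2 + d := by
    simp only [hφφ, ← pow_mul]
    refine exists_pow_add_self_eq (m := 1) (by omega) (by rw [hF]; ring) ?_
    have hd' : φ d = 1 + d := by linear_combination hd - d * htwo
    have hfix : φ (φ (d ^ 2 + d)) = d ^ 2 + d := by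
      simp only [map_add, map_pow, hd', map_one]
      linear_combination (3 + 2 * d) * htwo
    rw [hφφ, ← pow_mul] at hfix
    simp only [sum_range_succ, sum_range_zero, pow_zero, pow_one, hfix, zero_add]
    exact CharTwo.add_self_eq_zero _
  have hfun : ∀ x : F, x ^ ((2 ^ k) ^ 2 + 2 ^ k + 1) + (x + 1) ^ ((2 ^ k) ^ 2 + 2 ^ k + 1) =
      blDeriv φ x := by
    intro x
    simp only [blDeriv, hφφ]
    simp only [hφq, pow_add, pow_one]
  simp only [hfun]
  classical
  obtain ⟨h4, h2, h0⟩ := card_fibres_two_four (blDeriv φ) (HasPartner φ)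
    (fun _ => card_fibre_of_hasPartner hφ) (fun _ => card_fibre_of_not_hasPartner hφ)
  have hhalf := two_mul_card_hasPartner hφ hAS hd hw
  simp only [ne_eq] at hhalf
  have hone := card_traceFour_eq_one hφ hq1 hφq hF
  have hsplit := card_filter_add_card_filter_not (s := (univ : Finset F))
    (fun x => traceFour φ x = 1)
  have hsplit' := card_filter_add_card_filter_not (s := (univ : Finset F)) (HasPartner φ)
  rw [card_univ, hF] at hsplit hsplit'
  rw [hF] at h0
  refine ⟨?_, ?_, ?_⟩ <;> omega
end
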